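/- Let ξ and η be two commuting Killing vector fields on a pseudo-Riemannian manifold (M, g) whose Ricci tensor leaves the 2-plane spanned by ξ and η invariant at each point, i.e. R^α_ρ ξ^ρ = a₁ ξ^α + b₁ η^α and R^α_ρ η^ρ = a₂ ξ^α + b₂ η^α for some functions a_i, b_i. Then the 3-form-valued quantities η_[α ξ_β ∇_λ ξ_ρ] and ξ_[α η_β ∇_λ η_ρ] are covariantly divergence-free: ∇^ρ( η_[α ξ_β ∇_λ ξ_ρ] ) = 0 and ∇^ρ( ξ_[α η_β ∇_λ η_ρ] ) = 0. -/

import Mathlib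

/-!
Coordinate (local-chart) formalization of pseudo-Riemannian geometry on `ℝⁿ`:
manifolds are modeled by `Pt n = Fin n → ℝ`, tensor fields by their component
functions, and all differential-geometric operations (Lie derivatives, the
Levi-Civita connection via Christoffel symbols, curvature, pullbacks along
embeddings, exterior derivatives and wedge products) are defined explicitly.
-/

noncomputable section
open scoped BigOperators

abbrev Pt (n : ℕ) : Type := Fin n → ℝ

/-- Partial derivative `∂_a f` of a scalar function. -/
def pd {n : ℕ} (f : Pt n → ℝ) (a : Fin n) (x : Pt n) : ℝ :=
  fderiv ℝ f x (Pi.single a 1)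

/-- Pairing of a covector (components `ω`) with a vector (components `u`). -/
def ip {n : ℕ} (ω u : Fin n → ℝ) : ℝ := ∑ α, ω α * u α

/-- Scalar product of two vectors with respect to the metric `g`. -/
def gdot {n : ℕ} (g : Pt n → Fin n → Fin n → ℝ) (x : Pt n) (u v : Fin n → ℝ) : ℝ :=
  ∑ a, ∑ b, g x a b * u a * v b

/-- Index lowering: the 1-form `ξ_♭` metrically dual to the vector field `ξ`. -/
def flat {n : ℕ} (g : Pt n → Fin n → Fin n → ℝ) (ξ : Pt n → Pt n) (x : Pt n) (b : Fin n) : ℝ :=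
  ∑ c, g x b c * ξ x c

/-- Lie derivative `(ℒ_ξ g)_{ab}` of a symmetric 2-covariant tensor field `g`
along the vector field `ξ`. -/
def lieD {n : ℕ} (g : Pt n → Fin n → Fin n → ℝ) (ξ : Pt n → Pt n) (x : Pt n) (a b : Fin n) : ℝ :=
  ∑ c, (ξ x c * pd (fun y => g y a b) c x
      + g x c b * pd (fun y => ξ y c) a x
      + g x a c * pd (fun y => ξ y c) b x)

/-- Lie bracket `[ξ, η]` of two vector fields. -/
def lieBr {n : ℕ} (ξ η : Pt n → Pt n) (x : Pt n) : Pt n :=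
  fun a => ∑ b, (ξ x b * pd (fun y => η y a) b x - η x b * pd (fun y => ξ y a) b x)

/-- Christoffel symbols `Γ^a_{bc}` of the Levi-Civita connection of `g`
(`ginv` is the inverse metric). -/
def Chr {n : ℕ} (g ginv : Pt n → Fin n → Fin n → ℝ) (a b c : Fin n) (x : Pt n) : ℝ :=
  (1/2) * ∑ d, ginv x a d *
    (pd (fun y => g y d b) c x + pd (fun y => g y d c) b x - pd (fun y => g y b c) d x)

/-- Covariant derivative `∇_a ω_b` of a 1-form `ω`. -/
def covD {n : ℕ} (g ginv : Pt n → Fin n → Fin n → ℝ) (ω : Pt n → Fin n → ℝ)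
    (x : Pt n) (a b : Fin n) : ℝ :=
  pd (fun y => ω y b) a x - ∑ c, Chr g ginv c a b x * ω x c

/-- Covariant derivative `∇_m S_{abcd}` of a 4-covariant tensor field `S`. -/
def covD4 {n : ℕ} (g ginv : Pt n → Fin n → Fin n → ℝ)
    (S : Pt n → Fin n → Fin n → Fin n → Fin n → ℝ) (x : Pt n) (m a b c d : Fin n) : ℝ :=
  pd (fun y => S y a b c d) m x
    - ∑ e, Chr g ginv e m a x * S x e b c d
    - ∑ e, Chr g ginv e m b x * S x a e c d
    - ∑ e, Chr g ginv e m c x * S x a b e d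
    - ∑ e, Chr g ginv e m d x * S x a b c e

/-- Riemann tensor `R^a_{bcd}` of the Levi-Civita connection. -/
def Riem {n : ℕ} (g ginv : Pt n → Fin n → Fin n → ℝ) (a b c d : Fin n) (x : Pt n) : ℝ :=
  pd (fun y => Chr g ginv a d b y) c x - pd (fun y => Chr g ginv a c b y) d x
    + ∑ e, (Chr g ginv a c e x * Chr g ginv e d b x - Chr g ginv a d e x * Chr g ginv e c b x)

/-- Ricci tensor `R_{bd} = R^a_{bad}`. -/
def RicciT {n : ℕ} (g ginv : Pt n → Fin n → Fin n → ℝ) (b d : Fin n) (x : Pt n) : ℝ :=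
  ∑ a, Riem g ginv a b a d x

/-- Normalized antisymmetrization of a 3-index quantity. -/
def asym3 {ι : Type*} (T : ι → ι → ι → ℝ) (a b c : ι) : ℝ :=
  (1/6) * ∑ σ : Equiv.Perm (Fin 3),
    ((Equiv.Perm.sign σ : ℤ) : ℝ) * T (![a, b, c] (σ 0)) (![a, b, c] (σ 1)) (![a, b, c] (σ 2))

/-- Normalized antisymmetrization of a 4-index quantity. -/
def asym4 {ι : Type*} (T : ι → ι → ι → ι → ℝ) (a b c d : ι) : ℝ :=
  (1/24) * ∑ σ : Equiv.Perm (Fin 4),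
    ((Equiv.Perm.sign σ : ℤ) : ℝ) *
      T (![a, b, c, d] (σ 0)) (![a, b, c, d] (σ 1)) (![a, b, c, d] (σ 2)) (![a, b, c, d] (σ 3))

/-- Pullback `Φ* g` of a 2-covariant tensor field along a map `Φ`
(first fundamental form when `Φ` is an embedding and `g` the metric). -/
def pull2 {d m : ℕ} (Φ : Pt d → Pt m) (g : Pt m → Fin m → Fin m → ℝ)
    (p : Pt d) (a b : Fin d) : ℝ :=
  ∑ α, ∑ β, g (Φ p) α β *
    fderiv ℝ Φ p (Pi.single a 1) α * fderiv ℝ Φ p (Pi.single b 1) β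

/-- The tangent frame `e_a = dΦ(∂/∂λ^a)` along the hypersurface `Σ = Φ(σ)`. -/
def eF {d : ℕ} (Φ : Pt d → Pt (d+1)) (a : Fin d) (p : Pt d) : Pt (d+1) :=
  fderiv ℝ Φ p (Pi.single a 1)

/-- Exterior derivative `dω` of a 1-form evaluated on two vectors:
`dω(u,v) = u^α v^β (∂_α ω_β - ∂_β ω_α)`. -/
def dext {n : ℕ} (ω : Pt n → Fin n → ℝ) (x : Pt n) (u v : Fin n → ℝ) : ℝ :=
  ∑ α, ∑ β, u α * v β * (pd (fun y => ω y β) α x - pd (fun y => ω y α) β x)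

/-- Wedge product of two covectors evaluated on two vectors. -/
def wdg2 {n : ℕ} (ω τ : Fin n → ℝ) (u v : Fin n → ℝ) : ℝ :=
  ip ω u * ip τ v - ip ω v * ip τ u

/-- Wedge product of four covectors evaluated on four vectors (determinant convention). -/
def wdg4 {n : ℕ} (ω₁ ω₂ ω₃ ω₄ : Fin n → ℝ) (u : Fin 4 → Fin n → ℝ) : ℝ :=
  ∑ σ : Equiv.Perm (Fin 4), ((Equiv.Perm.sign σ : ℤ) : ℝ) *
    (ip ω₁ (u (σ 0)) * ip ω₂ (u (σ 1)) * ip ω₃ (u (σ 2)) * ip ω₄ (u (σ 3)))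

/-- The 4-form `A_♭ ∧ B_♭ ∧ d(B_♭)` built from two vector fields `A`, `B`
(indices lowered with `g`), evaluated on four vectors. -/
def form4 {n : ℕ} (g : Pt n → Fin n → Fin n → ℝ) (A B : Pt n → Pt n) (x : Pt n)
    (u : Fin 4 → Fin n → ℝ) : ℝ :=
  (1/2) * ∑ σ : Equiv.Perm (Fin 4), ((Equiv.Perm.sign σ : ℤ) : ℝ) *
    (ip (flat g A x) (u (σ 0)) * ip (flat g B x) (u (σ 1)) *
      dext (flat g B) x (u (σ 2)) (u (σ 3)))

/-- Covariant derivative `∇_{e_a} ℓ` of a vector field `ℓ` defined along `Σ = Φ(σ)`. -/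
def covVecS {d : ℕ} (g ginv : Pt (d+1) → Fin (d+1) → Fin (d+1) → ℝ) (Φ : Pt d → Pt (d+1))
    (ℓ : Pt d → Pt (d+1)) (a : Fin d) (p : Pt d) : Pt (d+1) :=
  fun μ => pd (fun q => ℓ q μ) a p + ∑ ν, ∑ ρ, Chr g ginv μ ν ρ (Φ p) * eF Φ a p ν * ℓ p ρ

/-- The lowered components `ℓ_ν` along `Σ` of a vector field `ℓ` defined along `Σ`. -/
def flatS {d : ℕ} (g : Pt (d+1) → Fin (d+1) → Fin (d+1) → ℝ) (Φ : Pt d → Pt (d+1))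
    (ℓ : Pt d → Pt (d+1)) (p : Pt d) (ν : Fin (d+1)) : ℝ :=
  ∑ ρ, g (Φ p) ν ρ * ℓ p ρ

/-- Generalized second fundamental form `H_{ab} = e_a^μ e_b^ν ∇_μ ℓ_ν`
with respect to the rigging `ℓ`. -/
def Hgen {d : ℕ} (g ginv : Pt (d+1) → Fin (d+1) → Fin (d+1) → ℝ) (Φ : Pt d → Pt (d+1))
    (ℓ : Pt d → Pt (d+1)) (a b : Fin d) (p : Pt d) : ℝ :=
  ∑ ν, eF Φ b p ν * (pd (fun q => flatS g Φ ℓ q ν) a p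
    - ∑ c, (∑ μ, eF Φ a p μ * Chr g ginv c μ ν (Φ p)) * flatS g Φ ℓ p c)

/-- Transversal component `B_a = 2 ℓ^α e_a^β ∇_{[α} ω_{β]}` of `dω` along `Σ`. -/
def Bcoef {d : ℕ} (g ginv : Pt (d+1) → Fin (d+1) → Fin (d+1) → ℝ) (Φ : Pt d → Pt (d+1))
    (ℓ : Pt d → Pt (d+1)) (ω : Pt (d+1) → Fin (d+1) → ℝ) (a : Fin d) (p : Pt d) : ℝ :=
  ∑ α, ∑ β, ℓ p α * eF Φ a p β * (covD g ginv ω (Φ p) α β - covD g ginv ω (Φ p) β α)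

/-- Tangential component `A_{ab} = e_{[a}(ω_{b]})` of `dω` along `Σ`. -/
def Acoef {d : ℕ} (Φ : Pt d → Pt (d+1)) (ω : Pt (d+1) → Fin (d+1) → ℝ)
    (a b : Fin d) (p : Pt d) : ℝ :=
  (1/2) * (pd (fun q => ip (ω (Φ q)) (eF Φ b q)) a p - pd (fun q => ip (ω (Φ q)) (eF Φ a q)) b p)

/-- The identified frame `{ℓ, e_a}` along `Σ`, indexed by `Option (Fin d)`. -/
def frameV {d : ℕ} (Φ : Pt d → Pt (d+1)) (ℓ : Pt d → Pt (d+1)) (p : Pt d) :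
    Option (Fin d) → Pt (d+1)
  | none => ℓ p
  | some a => eF Φ a p

theorem asym4_eq_sum_insert {ι : Type*} (T : ι → ι → ι → ι → ℝ) (a b c r : ι) :
    asym4 T a b c r = (1/24) *
      ((-T r a b c + T a r b c - T a b r c + T a b c r)
      + (-T r b c a + T b r c a - T b c r a + T b c a r)
      + (-T r c a b + T c r a b - T c a r b + T c a b r)
      - (-T r b a c + T b r a c - T b a r c + T b a c r)
      - (-T r a c b + T a r c b - T a c r b + T a c b r)
      - (-T r c b a + T c r b a - T c b r a + T c b a r)) := by
  have h1 : ∀ f : Equiv.Perm (Fin 4) → ℝ, ∑ σ, f σ = ∑ p : Fin 4 × Equiv.Perm (Fin 3),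
      f (Equiv.Perm.decomposeFin.symm p) := fun f => (Equiv.sum_comp _ f).symm
  have h2 : ∀ f : Equiv.Perm (Fin 3) → ℝ, ∑ σ, f σ = ∑ p : Fin 3 × Equiv.Perm (Fin 2),
      f (Equiv.Perm.decomposeFin.symm p) := fun f => (Equiv.sum_comp _ f).symm
  have h3 : ∀ f : Equiv.Perm (Fin 2) → ℝ, ∑ σ, f σ = f 1 + f (Equiv.swap 0 1) := by
    intro f
    rw [show (Finset.univ : Finset (Equiv.Perm (Fin 2))) = {1, Equiv.swap 0 1} by decide,
      Finset.sum_pair (by decide)]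
  unfold asym4
  congr 1
  have d0 : ∀ (n : ℕ) (p : Fin (n+1)) (e : Equiv.Perm (Fin n)),
    Equiv.Perm.decomposeFin.symm (p, e) 0 = p := fun n p e =>
      Equiv.Perm.decomposeFin_symm_apply_zero p e
  have d1 : ∀ (n : ℕ) (p : Fin (n+1)) (e : Equiv.Perm (Fin n)) (x : Fin n),
    Equiv.Perm.decomposeFin.symm (p, e) x.succ = Equiv.swap 0 p (e x).succ := fun n p e x =>
      Equiv.Perm.decomposeFin_symm_apply_succ e p x
  have k1 : ∀ (p : Fin 4) (e : Equiv.Perm (Fin 3)),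
    Equiv.Perm.decomposeFin.symm (p, e) 1 = Equiv.swap 0 p (e 0).succ := fun p e => d1 _ p e 0
  have k2 : ∀ (p : Fin 4) (e : Equiv.Perm (Fin 3)),
    Equiv.Perm.decomposeFin.symm (p, e) 2 = Equiv.swap 0 p (e 1).succ := fun p e => d1 _ p e 1
  have k3 : ∀ (p : Fin 4) (e : Equiv.Perm (Fin 3)),
    Equiv.Perm.decomposeFin.symm (p, e) 3 = Equiv.swap 0 p (e 2).succ := fun p e => d1 _ p e 2
  have l1 : ∀ (p : Fin 3) (e : Equiv.Perm (Fin 2)),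
    Equiv.Perm.decomposeFin.symm (p, e) 1 = Equiv.swap 0 p (e 0).succ := fun p e => d1 _ p e 0
  have l2 : ∀ (p : Fin 3) (e : Equiv.Perm (Fin 2)),
    Equiv.Perm.decomposeFin.symm (p, e) 2 = Equiv.swap 0 p (e 1).succ := fun p e => d1 _ p e 1
  simp only [h1, Fintype.sum_prod_type, h2, h3, Fin.sum_univ_four, Fin.sum_univ_three,
    Equiv.Perm.decomposeFin.symm_sign, d0, k1, k2, k3, l1, l2, Equiv.Perm.one_apply,
    Equiv.swap_apply_left, Equiv.swap_apply_right, Equiv.swap_self, Equiv.refl_apply, Fin.reduceSucc]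
  simp [Equiv.swap_apply_def]
  ring

/-- The algebraic core of the theorem: the trace over the derivative index and the last index of
the derivative of `u ∧ v ∧ F`, where `E` and `F` are the (antisymmetric) derivatives of `u` and
`v`, and `D` is the derivative of `F`. -/
theorem trace_asym4_eq_zero {ι : Type*} [Fintype ι] (G E F : ι → ι → ℝ) (D : ι → ι → ι → ℝ)
    (u v : ι → ℝ) (p q : ℝ)
    (hG : ∀ a b, G a b = G b a) (hE : ∀ a b, E a b = -E b a) (hF : ∀ a b, F a b = -F b a)
    (hD : ∀ m a b, D m a b = -D m b a)
    (hEF : ∀ b, ∑ r, ∑ m, G r m * (u r * F m b) = ∑ r, ∑ m, G r m * (v r * E m b))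
    (hu : ∀ c d, ∑ r, ∑ m, G r m * (u r * D m c d)
      = ∑ r, ∑ m, G r m * (E m c * F r d) - ∑ r, ∑ m, G r m * (E m d * F r c))
    (hv : ∀ c d, ∑ r, ∑ m, G r m * (v r * D m c d)
      = ∑ r, ∑ m, G r m * (F m c * F r d) - ∑ r, ∑ m, G r m * (F m d * F r c))
    (hdiv : ∀ c, ∑ r, ∑ m, G r m * D m c r = p * v c + q * u c) (a b c : ι) :
    ∑ r, ∑ m, G r m * asym4 (fun a b c d =>
      E m a * v b * F c d + u a * F m b * F c d + u a * v b * D m c d) a b c r = 0 := by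
  have tr0 : ∀ H : ι → ι → ℝ, (∀ a b, H a b = -H b a) → ∑ r, ∑ m, G r m * H m r = 0 := by
    intro H hH
    have : ∑ r, ∑ m, G r m * H m r = -∑ r, ∑ m, G r m * H m r := by
      conv_lhs => rw [Finset.sum_comm]
      rw [← Finset.sum_neg_distrib]
      refine Finset.sum_congr rfl fun r _ => ?_
      rw [← Finset.sum_neg_distrib]
      refine Finset.sum_congr rfl fun m _ => ?_
      rw [hG, hH]; ring
    linarith
  have tE := tr0 E hE
  have tF := tr0 F hF
  have hsymm : ∀ x y, ∑ r, ∑ m, G r m * (F m x * F r y) = ∑ r, ∑ m, G r m * (F m y * F r x) := by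
    intro x y
    rw [Finset.sum_comm]
    refine Finset.sum_congr rfl fun r _ => Finset.sum_congr rfl fun m _ => ?_
    rw [hG]; ring
  have key : ∀ x y z : ι, ∀ T : ι → ι → ι → ι → ι → ℝ,
      T = (fun m a b c d => E m a * v b * F c d + u a * F m b * F c d + u a * v b * D m c d) →
      ∑ r, ∑ m, G r m * (-T m r x y z + T m x r y z - T m x y r z + T m x y z r)
        = - v x * (∑ r, ∑ m, G r m * (E m y * F r z) - ∑ r, ∑ m, G r m * (E m z * F r y))
          - 2 * v y * ∑ r, ∑ m, G r m * (E m x * F r z)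
          - 2 * u x * ∑ r, ∑ m, G r m * (F m y * F r z)
          + 2 * u x * v y * (p * v z + q * u z) := by
    rintro x y z T rfl
    have h : ∑ r, ∑ m, G r m * (-(E m r * v x * F y z + u r * F m x * F y z + u r * v x * D m y z)
          + (E m x * v r * F y z + u x * F m r * F y z + u x * v r * D m y z)
          - (E m x * v y * F r z + u x * F m y * F r z + u x * v y * D m r z)
          + (E m x * v y * F z r + u x * F m y * F z r + u x * v y * D m z r))
        = (- v x * F y z) * ∑ r, ∑ m, G r m * E m r
          + (- F y z) * ∑ r, ∑ m, G r m * (u r * F m x)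
          + (- v x) * ∑ r, ∑ m, G r m * (u r * D m y z)
          + F y z * ∑ r, ∑ m, G r m * (v r * E m x)
          + (u x * F y z) * ∑ r, ∑ m, G r m * F m r
          + u x * ∑ r, ∑ m, G r m * (v r * D m y z)
          + (-2 * v y) * ∑ r, ∑ m, G r m * (E m x * F r z)
          + (-2 * u x) * ∑ r, ∑ m, G r m * (F m y * F r z)
          + (2 * u x * v y) * ∑ r, ∑ m, G r m * D m z r := by
      simp only [Finset.mul_sum, ← Finset.sum_add_distrib]
      refine Finset.sum_congr rfl fun r _ => Finset.sum_congr rfl fun m _ => ?_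
      rw [hF z r, hD m r z]; ring
    rw [h, tE, tF, hEF, hu, hv, hdiv, hsymm z y]; ring
  obtain ⟨T, hT⟩ : ∃ T : ι → ι → ι → ι → ι → ℝ, T = (fun m a b c d =>
    E m a * v b * F c d + u a * F m b * F c d + u a * v b * D m c d) := ⟨_, rfl⟩
  have hsum : ∑ r, ∑ m, G r m * asym4 (T m) a b c r = (1/24) *
      ((∑ r, ∑ m, G r m * (-T m r a b c + T m a r b c - T m a b r c + T m a b c r))
      + (∑ r, ∑ m, G r m * (-T m r b c a + T m b r c a - T m b c r a + T m b c a r))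
      + (∑ r, ∑ m, G r m * (-T m r c a b + T m c r a b - T m c a r b + T m c a b r))
      - (∑ r, ∑ m, G r m * (-T m r b a c + T m b r a c - T m b a r c + T m b a c r))
      - (∑ r, ∑ m, G r m * (-T m r a c b + T m a r c b - T m a c r b + T m a c b r))
      - (∑ r, ∑ m, G r m * (-T m r c b a + T m c r b a - T m c b r a + T m c b a r))) := by
    simp only [Finset.mul_sum, ← Finset.sum_add_distrib, ← Finset.sum_sub_distrib]
    refine Finset.sum_congr rfl fun r _ => Finset.sum_congr rfl fun m _ => ?_
    rw [asym4_eq_sum_insert]; ring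
  have hT' : ∀ m, (fun a b c d => E m a * v b * F c d + u a * F m b * F c d + u a * v b * D m c d)
    = T m := fun m => by rw [hT]
  simp only [hT']
  rw [hsum]
  simp only [key _ _ _ T hT]
  rw [hsymm b a, hsymm c a, hsymm c b]
  ring

/-- Covariant derivative `∇_m F_{ab}` of a 2-covariant tensor field `F`. -/
def covD2 {n : ℕ} (g ginv : Pt n → Fin n → Fin n → ℝ)
    (F : Pt n → Fin n → Fin n → ℝ) (x : Pt n) (m a b : Fin n) : ℝ :=
  pd (fun y => F y a b) m x - ∑ e, Chr g ginv e m a x * F x e b - ∑ e, Chr g ginv e m b x * F x a e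

section PartialDerivative

variable {n : ℕ} {f h : Pt n → ℝ} {x : Pt n}

theorem pd_add (hf : DifferentiableAt ℝ f x) (hh : DifferentiableAt ℝ h x) (a : Fin n) :
    pd (fun y => f y + h y) a x = pd f a x + pd h a x := by
  simp [pd, fderiv_fun_add hf hh]

theorem pd_sub (hf : DifferentiableAt ℝ f x) (hh : DifferentiableAt ℝ h x) (a : Fin n) :
    pd (fun y => f y - h y) a x = pd f a x - pd h a x := by
  simp [pd, fderiv_fun_sub hf hh]

theorem pd_mul (hf : DifferentiableAt ℝ f x) (hh : DifferentiableAt ℝ h x) (a : Fin n) :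
    pd (fun y => f y * h y) a x = f x * pd h a x + h x * pd f a x := by
  simp [pd, fderiv_fun_mul hf hh]

theorem pd_const_mul (hf : DifferentiableAt ℝ f x) (c : ℝ) (a : Fin n) :
    pd (fun y => c * f y) a x = c * pd f a x := by
  simp [pd, fderiv_const_mul hf]

theorem pd_sum {ι : Type*} (s : Finset ι) {f : ι → Pt n → ℝ}
    (hf : ∀ i ∈ s, DifferentiableAt ℝ (f i) x) (a : Fin n) :
    pd (fun y => ∑ i ∈ s, f i y) a x = ∑ i ∈ s, pd (f i) a x := by
  simp [pd, fderiv_fun_sum hf]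

theorem contDiff_pd (hf : ContDiff ℝ (⊤ : ℕ∞) f) (a : Fin n) :
    ContDiff ℝ (⊤ : ℕ∞) (pd f a) :=
  (hf.fderiv_right (m := (⊤ : ℕ∞)) (by simp)).clm_apply contDiff_const

theorem pd_comm (hf : ContDiff ℝ (⊤ : ℕ∞) f) (a b : Fin n) (x : Pt n) :
    pd (pd f a) b x = pd (pd f b) a x := by
  have hd : DifferentiableAt ℝ (fderiv ℝ f) x :=
    (hf.fderiv_right (m := (⊤ : ℕ∞)) (by simp)).differentiable (by simp) x
  have h : ∀ c d, pd (pd f c) d x = fderiv ℝ (fderiv ℝ f) x (Pi.single d 1) (Pi.single c 1) := by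
    intro c d
    unfold pd
    rw [fderiv_clm_apply hd (differentiableAt_const _)]
    simp
  rw [h, h]
  exact (hf.contDiffAt.isSymmSndFDerivAt (by
    simpa using (WithTop.coe_le_coe.2 le_top : ((2 : ℕ∞) : WithTop ℕ∞) ≤ ((⊤ : ℕ∞) : WithTop ℕ∞)))).eq _ _

end PartialDerivative

theorem covD4_asym4 {n : ℕ} (g ginv : Pt n → Fin n → Fin n → ℝ)
    (T : Pt n → Fin n → Fin n → Fin n → Fin n → ℝ) (x : Pt n)
    (hT : ∀ a b c d, DifferentiableAt ℝ (fun y => T y a b c d) x) (m a b c d : Fin n) :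
    covD4 g ginv (fun y => asym4 (T y)) x m a b c d = asym4 (covD4 g ginv T x m) a b c d := by
  have hpd : pd (fun y => asym4 (T y) a b c d) m x
      = asym4 (fun a b c d => pd (fun y => T y a b c d) m x) a b c d := by
    unfold asym4
    rw [pd_const_mul (DifferentiableAt.fun_sum fun _ _ => (hT _ _ _ _).const_mul _),
      pd_sum _ fun _ _ => (hT _ _ _ _).const_mul _]
    congr 1
    exact Finset.sum_congr rfl fun σ _ => pd_const_mul (hT _ _ _ _) _ _
  unfold covD4
  rw [hpd]
  simp only [asym4_eq_sum_insert, mul_add, mul_sub, mul_neg, mul_left_comm _ (1/24 : ℝ),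
    Finset.sum_add_distrib, Finset.sum_sub_distrib, Finset.sum_neg_distrib, ← Finset.mul_sum]
  ring

theorem covD4_mul_mul {n : ℕ} (g ginv : Pt n → Fin n → Fin n → ℝ)
    (u v : Pt n → Fin n → ℝ) (F : Pt n → Fin n → Fin n → ℝ) (x : Pt n)
    (hu : ∀ a, DifferentiableAt ℝ (fun y => u y a) x)
    (hv : ∀ a, DifferentiableAt ℝ (fun y => v y a) x)
    (hF : ∀ a b, DifferentiableAt ℝ (fun y => F y a b) x) (m a b c d : Fin n) :
    covD4 g ginv (fun y a b c d => u y a * v y b * F y c d) x m a b c d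
      = covD g ginv u x m a * v x b * F x c d + u x a * covD g ginv v x m b * F x c d
        + u x a * v x b * covD2 g ginv F x m c d := by
  unfold covD4 covD covD2
  beta_reduce
  rw [pd_mul ((hu a).fun_mul (hv b)) (hF c d), pd_mul (hu a) (hv b)]
  simp only [mul_sub, sub_mul, Finset.mul_sum, Finset.sum_mul]
  simp only [show ∀ e, Chr g ginv e m a x * (u x e * v x b * F x c d)
      = Chr g ginv e m a x * u x e * v x b * F x c d from fun e => by ring,
    show ∀ e, Chr g ginv e m b x * (u x a * v x e * F x c d)
      = u x a * (Chr g ginv e m b x * v x e) * F x c d from fun e => by ring,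
    show ∀ e, Chr g ginv e m c x * (u x a * v x b * F x e d)
      = u x a * v x b * (Chr g ginv e m c x * F x e d) from fun e => by ring,
    show ∀ e, Chr g ginv e m d x * (u x a * v x b * F x c e)
      = u x a * v x b * (Chr g ginv e m d x * F x c e) from fun e => by ring]
  ring

/-- Covariant derivative `∇_a ξ^m` of a vector field `ξ`. -/
def covV {n : ℕ} (g ginv : Pt n → Fin n → Fin n → ℝ) (ξ : Pt n → Pt n)
    (x : Pt n) (a m : Fin n) : ℝ :=
  pd (fun y => ξ y m) a x + ∑ e, Chr g ginv m a e x * ξ x e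

section LeviCivita

variable {n : ℕ} {g ginv : Pt n → Fin n → Fin n → ℝ} {ξ η : Pt n → Pt n}

theorem contDiff_Chr (hg : ∀ a b, ContDiff ℝ (⊤ : ℕ∞) fun x => g x a b)
    (hginv : ∀ a b, ContDiff ℝ (⊤ : ℕ∞) fun x => ginv x a b) (a b c : Fin n) :
    ContDiff ℝ (⊤ : ℕ∞) (Chr g ginv a b c) := by
  unfold Chr
  exact contDiff_const.mul (ContDiff.sum fun d _ => (hginv a d).mul
    (((contDiff_pd (hg d b) c).add (contDiff_pd (hg d c) b)).sub (contDiff_pd (hg b c) d)))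

theorem contDiff_comp (hξ : ContDiff ℝ (⊤ : ℕ∞) ξ) (a : Fin n) :
    ContDiff ℝ (⊤ : ℕ∞) fun x => ξ x a :=
  contDiff_pi.1 hξ a

theorem contDiff_flat (hg : ∀ a b, ContDiff ℝ (⊤ : ℕ∞) fun x => g x a b)
    (hξ : ContDiff ℝ (⊤ : ℕ∞) ξ) (a : Fin n) : ContDiff ℝ (⊤ : ℕ∞) fun x => flat g ξ x a := by
  unfold flat
  exact ContDiff.sum fun c _ => (hg a c).mul (contDiff_comp hξ c)

theorem contDiff_covV (hg : ∀ a b, ContDiff ℝ (⊤ : ℕ∞) fun x => g x a b)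
    (hginv : ∀ a b, ContDiff ℝ (⊤ : ℕ∞) fun x => ginv x a b)
    (hξ : ContDiff ℝ (⊤ : ℕ∞) ξ) (a b : Fin n) :
    ContDiff ℝ (⊤ : ℕ∞) fun x => covV g ginv ξ x a b := by
  unfold covV
  exact (contDiff_pd (contDiff_comp hξ b) a).add
    (ContDiff.sum fun e _ => (contDiff_Chr hg hginv b a e).mul (contDiff_comp hξ e))

theorem contDiff_covD (hg : ∀ a b, ContDiff ℝ (⊤ : ℕ∞) fun x => g x a b)
    (hginv : ∀ a b, ContDiff ℝ (⊤ : ℕ∞) fun x => ginv x a b) {ω : Pt n → Fin n → ℝ}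
    (hω : ∀ a, ContDiff ℝ (⊤ : ℕ∞) fun x => ω x a) (a b : Fin n) :
    ContDiff ℝ (⊤ : ℕ∞) fun x => covD g ginv ω x a b := by
  unfold covD
  exact (contDiff_pd (hω b) a).sub
    (ContDiff.sum fun e _ => (contDiff_Chr hg hginv e a b).mul (hω e))

theorem Chr_symm (hgsymm : ∀ x a b, g x a b = g x b a) (a b c : Fin n) (x : Pt n) :
    Chr g ginv a b c x = Chr g ginv a c b x := by
  unfold Chr
  simp only [fun y => hgsymm y b c]
  congr 1
  exact Finset.sum_congr rfl fun d _ => by ring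

theorem sum_mul_sum_of_mul_eq_one {A B : Fin n → Fin n → ℝ}
    (h : ∀ a b, (∑ c, A a c * B c b) = if a = b then (1 : ℝ) else 0) (v : Fin n → ℝ) (a : Fin n) :
    ∑ c, A a c * ∑ e, B c e * v e = v a := by
  calc ∑ c, A a c * ∑ e, B c e * v e = ∑ e, (∑ c, A a c * B c e) * v e := by
        simp only [Finset.mul_sum, Finset.sum_mul]
        rw [Finset.sum_comm]
        simp only [mul_assoc]
    _ = v a := by simp [h]

theorem sum_metric_mul_inv (hgsymm : ∀ x a b, g x a b = g x b a)
    (hginvsymm : ∀ x a b, ginv x a b = ginv x b a)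
    (hinv : ∀ x a b, (∑ c, ginv x a c * g x c b) = if a = b then (1 : ℝ) else 0)
    (x : Pt n) (a b : Fin n) :
    (∑ c, g x a c * ginv x c b) = if a = b then (1 : ℝ) else 0 := by
  calc ∑ c, g x a c * ginv x c b = ∑ c, ginv x b c * g x c a :=
        Finset.sum_congr rfl fun c _ => by rw [hgsymm, hginvsymm]; ring
    _ = _ := by simp only [hinv, eq_comm]

theorem sum_g_mul_Chr (hinv' : ∀ x a b, (∑ c, g x a c * ginv x c b) = if a = b then (1 : ℝ) else 0)
    (x : Pt n) (d a b : Fin n) :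
    ∑ c, g x d c * Chr g ginv c a b x = (1/2) * (pd (fun y => g y d a) b x
      + pd (fun y => g y d b) a x - pd (fun y => g y a b) d x) := by
  unfold Chr
  simp only [mul_left_comm _ (1/2 : ℝ), ← Finset.mul_sum]
  rw [sum_mul_sum_of_mul_eq_one (hinv' x)]

theorem pd_metric (hgsymm : ∀ x a b, g x a b = g x b a)
    (hinv' : ∀ x a b, (∑ c, g x a c * ginv x c b) = if a = b then (1 : ℝ) else 0)
    (x : Pt n) (m a b : Fin n) :
    pd (fun y => g y a b) m x
      = ∑ e, g x b e * Chr g ginv e m a x + ∑ e, g x a e * Chr g ginv e m b x := by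
  rw [sum_g_mul_Chr hinv', sum_g_mul_Chr hinv']
  simp only [fun y => hgsymm y b a, fun y => hgsymm y b m, fun y => hgsymm y m a]
  ring

theorem covD_flat (hg : ∀ a b, ContDiff ℝ (⊤ : ℕ∞) fun x => g x a b)
    (hgsymm : ∀ x a b, g x a b = g x b a)
    (hinv' : ∀ x a b, (∑ c, g x a c * ginv x c b) = if a = b then (1 : ℝ) else 0)
    (hξ : ContDiff ℝ (⊤ : ℕ∞) ξ) (x : Pt n) (a b : Fin n) :
    covD g ginv (flat g ξ) x a b = ∑ m, g x b m * covV g ginv ξ x a m := by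
  have dg : ∀ c d, DifferentiableAt ℝ (fun y => g y c d) x :=
    fun c d => (hg c d).differentiable (by simp) x
  have dξ : ∀ c, DifferentiableAt ℝ (fun y => ξ y c) x :=
    fun c => (contDiff_comp hξ c).differentiable (by simp) x
  unfold covD covV flat
  rw [pd_sum _ fun c _ => (dg b c).fun_mul (dξ c)]
  simp only [fun c => pd_mul (dg b c) (dξ c) a, pd_metric hgsymm hinv', mul_add,
    Finset.sum_add_distrib, Finset.mul_sum]
  have e1 : ∑ c, ∑ e, ξ x c * (g x c e * Chr g ginv e a b x)
      = ∑ c, ∑ e, Chr g ginv c a b x * (g x c e * ξ x e) := by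
    rw [Finset.sum_comm]
    exact Finset.sum_congr rfl fun c _ => Finset.sum_congr rfl fun e _ => by
      rw [hgsymm x e c]; ring
  have e2 : ∑ c, ∑ e, ξ x c * (g x b e * Chr g ginv e a c x)
      = ∑ c, ∑ e, g x b c * (Chr g ginv c a e x * ξ x e) := by
    rw [Finset.sum_comm]
    exact Finset.sum_congr rfl fun c _ => Finset.sum_congr rfl fun e _ => by ring
  rw [e1, e2]
  ring

/-- Raising an index commutes with covariant differentiation. -/
theorem covD2_covD_flat (hg : ∀ a b, ContDiff ℝ (⊤ : ℕ∞) fun x => g x a b)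
    (hginv : ∀ a b, ContDiff ℝ (⊤ : ℕ∞) fun x => ginv x a b)
    (hgsymm : ∀ x a b, g x a b = g x b a)
    (hinv' : ∀ x a b, (∑ c, g x a c * ginv x c b) = if a = b then (1 : ℝ) else 0)
    (hξ : ContDiff ℝ (⊤ : ℕ∞) ξ) (x : Pt n) (m c r : Fin n) :
    covD2 g ginv (covD g ginv (flat g ξ)) x m c r
      = ∑ k, g x r k * (pd (fun y => covV g ginv ξ y c k) m x
          - ∑ e, Chr g ginv e m c x * covV g ginv ξ x e k
          + ∑ e, Chr g ginv k m e x * covV g ginv ξ x c e) := by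
  have dg : ∀ c d, DifferentiableAt ℝ (fun y => g y c d) x :=
    fun c d => (hg c d).differentiable (by simp) x
  have dN : ∀ c d, DifferentiableAt ℝ (fun y => covV g ginv ξ y c d) x :=
    fun c d => (contDiff_covV hg hginv hξ c d).differentiable (by simp) x
  unfold covD2
  simp only [covD_flat hg hgsymm hinv' hξ]
  rw [pd_sum _ fun k _ => (dg r k).fun_mul (dN c k)]
  simp only [fun k => pd_mul (dg r k) (dN c k) m, pd_metric hgsymm hinv', mul_add, mul_sub,
    Finset.sum_add_distrib, Finset.sum_sub_distrib, Finset.mul_sum]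
  have e1 : ∑ k, ∑ e, covV g ginv ξ x c k * (g x k e * Chr g ginv e m r x)
      = ∑ e, ∑ k, Chr g ginv e m r x * (g x e k * covV g ginv ξ x c k) := by
    rw [Finset.sum_comm]
    exact Finset.sum_congr rfl fun c _ => Finset.sum_congr rfl fun e _ => by
      rw [hgsymm x e c]; ring
  have e2 : ∑ k, ∑ e, covV g ginv ξ x c k * (g x r e * Chr g ginv e m k x)
      = ∑ k, ∑ e, g x r k * (Chr g ginv k m e x * covV g ginv ξ x c e) := by
    rw [Finset.sum_comm]
    exact Finset.sum_congr rfl fun c _ => Finset.sum_congr rfl fun e _ => by ring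
  have e3 : ∑ e, ∑ k, Chr g ginv e m c x * (g x r k * covV g ginv ξ x e k)
      = ∑ k, ∑ e, g x r k * (Chr g ginv e m c x * covV g ginv ξ x e k) := by
    rw [Finset.sum_comm]
    exact Finset.sum_congr rfl fun c _ => Finset.sum_congr rfl fun e _ => by ring
  rw [e1, e2, e3]
  ring

theorem sum_inv_mul_covD_flat (hg : ∀ a b, ContDiff ℝ (⊤ : ℕ∞) fun x => g x a b)
    (hgsymm : ∀ x a b, g x a b = g x b a)
    (hinv : ∀ x a b, (∑ c, ginv x a c * g x c b) = if a = b then (1 : ℝ) else 0)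
    (hinv' : ∀ x a b, (∑ c, g x a c * ginv x c b) = if a = b then (1 : ℝ) else 0)
    (hξ : ContDiff ℝ (⊤ : ℕ∞) ξ) (x : Pt n) (a r : Fin n) :
    ∑ m, ginv x r m * covD g ginv (flat g ξ) x a m = covV g ginv ξ x a r := by
  simp only [covD_flat hg hgsymm hinv' hξ]
  exact sum_mul_sum_of_mul_eq_one (hinv x) _ _

/-- The contracted Christoffel symbol `Γ^a_{ab}` is (locally) a gradient. -/
theorem pd_trace_Chr_symm (hg : ∀ a b, ContDiff ℝ (⊤ : ℕ∞) fun x => g x a b)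
    (hginv : ∀ a b, ContDiff ℝ (⊤ : ℕ∞) fun x => ginv x a b)
    (hgsymm : ∀ x a b, g x a b = g x b a)
    (hginvsymm : ∀ x a b, ginv x a b = ginv x b a)
    (hinv : ∀ x a b, (∑ c, ginv x a c * g x c b) = if a = b then (1 : ℝ) else 0)
    (hinv' : ∀ x a b, (∑ c, g x a c * ginv x c b) = if a = b then (1 : ℝ) else 0)
    (x : Pt n) (b c : Fin n) :
    ∑ a, pd (Chr g ginv a a b) c x = ∑ a, pd (Chr g ginv a a c) b x := by
  have dg : ∀ y c d, DifferentiableAt ℝ (fun y => g y c d) y :=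
    fun y c d => (hg c d).differentiable (by simp) y
  have dgi : ∀ y c d, DifferentiableAt ℝ (fun y => ginv y c d) y :=
    fun y c d => (hginv c d).differentiable (by simp) y
  have trace : ∀ b y, ∑ a, Chr g ginv a a b y
      = ∑ a, ∑ d, (1/2) * (ginv y a d * pd (fun z => g z d a) b y) := by
    intro b y
    have h : ∑ a, ∑ d, ginv y a d * (pd (fun z => g z d b) a y - pd (fun z => g z a b) d y) = 0 := by
      have h' : ∑ a, ∑ d, ginv y a d * (pd (fun z => g z d b) a y - pd (fun z => g z a b) d y)
          = -∑ a, ∑ d, ginv y a d * (pd (fun z => g z d b) a y - pd (fun z => g z a b) d y) := by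
        conv_lhs => rw [Finset.sum_comm]
        simp only [← Finset.sum_neg_distrib]
        exact Finset.sum_congr rfl fun a _ => Finset.sum_congr rfl fun d _ => by
          rw [hginvsymm]; ring
      linarith
    have h2 : ∑ a, Chr g ginv a a b y = ∑ a, ∑ d, (1/2) * (ginv y a d * pd (fun z => g z d a) b y)
        + (1/2) * ∑ a, ∑ d, ginv y a d * (pd (fun z => g z d b) a y - pd (fun z => g z a b) d y) := by
      simp only [Chr, Finset.mul_sum, ← Finset.sum_add_distrib]
      exact Finset.sum_congr rfl fun a _ => Finset.sum_congr rfl fun d _ => by ring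
    rw [h2, h]; ring
  have pdinv : ∀ c a d, pd (fun y => ginv y a d) c x
      = -∑ e, ∑ f, ginv x a e * pd (fun y => g y e f) c x * ginv x f d := by
    intro c a d
    have h : ∀ f, ∑ e, (ginv x a e * pd (fun y => g y e f) c x
        + g x e f * pd (fun y => ginv y a e) c x) = 0 := by
      intro f
      have h0 : pd (fun y => ∑ e, ginv y a e * g y e f) c x = 0 := by
        simp only [hinv]; simp [pd]
      rw [pd_sum _ fun e _ => (dgi x a e).fun_mul (dg x e f)] at h0
      simpa only [fun e => pd_mul (dgi x a e) (dg x e f) c] using h0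
    have h2 : ∑ f, (∑ e, (ginv x a e * pd (fun y => g y e f) c x
        + g x e f * pd (fun y => ginv y a e) c x)) * ginv x f d = 0 := by simp [h]
    have h3 : ∑ f, ∑ e, g x e f * pd (fun y => ginv y a e) c x * ginv x f d
        = pd (fun y => ginv y a d) c x := by
      calc _ = ∑ e, (∑ f, g x e f * ginv x f d) * pd (fun y => ginv y a e) c x := by
            rw [Finset.sum_comm]
            simp only [Finset.sum_mul]
            exact Finset.sum_congr rfl fun a _ => Finset.sum_congr rfl fun d _ => by ring
        _ = _ := by simp [hinv']
    simp only [Finset.sum_mul, add_mul, Finset.sum_add_distrib] at h2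
    rw [h3, Finset.sum_comm] at h2
    linarith
  have hpd : ∀ b c, ∑ a, pd (Chr g ginv a a b) c x
      = ∑ a, ∑ d, (1/2) * (ginv x a d * pd (pd (fun z => g z d a) b) c x)
        - (1/2) * ∑ a, ∑ d, ∑ e, ∑ f, ginv x a e * pd (fun y => g y e f) c x * ginv x f d
          * pd (fun z => g z d a) b x := by
    intro b c
    have dp : ∀ a d, DifferentiableAt ℝ (pd (fun z => g z d a) b) x :=
      fun a d => (contDiff_pd (hg d a) b).differentiable (by simp) x
    rw [← pd_sum _ fun a _ => (contDiff_Chr hg hginv a a b).differentiable (by simp) x]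
    simp only [trace]
    rw [pd_sum _ fun a _ => DifferentiableAt.fun_sum fun d _ =>
      ((dgi x a d).fun_mul (dp a d)).const_mul _]
    simp only [Finset.mul_sum, ← Finset.sum_sub_distrib]
    refine Finset.sum_congr rfl fun a _ => ?_
    rw [pd_sum _ fun d _ => ((dgi x a d).fun_mul (dp a d)).const_mul _]
    refine Finset.sum_congr rfl fun d _ => ?_
    rw [pd_const_mul ((dgi x a d).fun_mul (dp a d)), pd_mul (dgi x a d) (dp a d), pdinv]
    simp only [← Finset.mul_sum, ← Finset.sum_mul]
    ring
  rw [hpd, hpd]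
  congr 1
  · exact Finset.sum_congr rfl fun a _ => Finset.sum_congr rfl fun d _ => by
      rw [pd_comm (hg d a)]
  · congr 1
    have reorder : ∀ Q : Fin n → Fin n → Fin n → Fin n → ℝ,
        ∑ a, ∑ d, ∑ e, ∑ f, Q a d e f = ∑ a, ∑ d, ∑ e, ∑ f, Q f e d a := by
      intro Q
      calc ∑ a, ∑ d, ∑ e, ∑ f, Q a d e f = ∑ p : ((Fin n × Fin n) × (Fin n × Fin n)),
            Q p.1.1 p.1.2 p.2.1 p.2.2 := by simp [Fintype.sum_prod_type]
        _ = ∑ p : ((Fin n × Fin n) × (Fin n × Fin n)), Q p.2.2 p.2.1 p.1.2 p.1.1 :=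
            Fintype.sum_equiv ((Equiv.prodComm _ _).trans
              ((Equiv.prodComm _ _).prodCongr (Equiv.prodComm _ _))) _ _ (fun p => by simp)
        _ = _ := by simp [Fintype.sum_prod_type]
    rw [reorder]
    refine Finset.sum_congr rfl fun a _ => Finset.sum_congr rfl fun d _ =>
      Finset.sum_congr rfl fun e _ => Finset.sum_congr rfl fun f _ => ?_
    rw [hginvsymm x f d, hginvsymm x a e]
    simp only [fun y => hgsymm y e f, fun y => hgsymm y d a]
    ring

theorem RicciT_symm (hg : ∀ a b, ContDiff ℝ (⊤ : ℕ∞) fun x => g x a b)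
    (hginv : ∀ a b, ContDiff ℝ (⊤ : ℕ∞) fun x => ginv x a b)
    (hgsymm : ∀ x a b, g x a b = g x b a)
    (hginvsymm : ∀ x a b, ginv x a b = ginv x b a)
    (hinv : ∀ x a b, (∑ c, ginv x a c * g x c b) = if a = b then (1 : ℝ) else 0)
    (hinv' : ∀ x a b, (∑ c, g x a c * ginv x c b) = if a = b then (1 : ℝ) else 0)
    (x : Pt n) (b d : Fin n) : RicciT g ginv b d x = RicciT g ginv d b x := by
  have ht := pd_trace_Chr_symm hg hginv hgsymm hginvsymm hinv hinv' x b d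
  have hs : ∀ a b c, Chr g ginv a b c = Chr g ginv a c b :=
    fun a b c => funext fun y => Chr_symm hgsymm a b c y
  have hq : ∑ a, ∑ e, Chr g ginv a d e x * Chr g ginv e a b x
      = ∑ a, ∑ e, Chr g ginv a b e x * Chr g ginv e a d x := by
    rw [Finset.sum_comm]
    exact Finset.sum_congr rfl fun a _ => Finset.sum_congr rfl fun e _ => by
      rw [hs e d a, hs a e b]; ring
  unfold RicciT Riem
  simp only [Finset.sum_add_distrib, Finset.sum_sub_distrib]
  rw [hq, ht]
  simp only [fun a => hs a d b]

end LeviCivita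

section Killing

variable {n : ℕ} {g ginv : Pt n → Fin n → Fin n → ℝ} {ξ η : Pt n → Pt n}

theorem sum_inv_mul_flat_mul (hginvsymm : ∀ x a b, ginv x a b = ginv x b a)
    (hinv : ∀ x a b, (∑ c, ginv x a c * g x c b) = if a = b then (1 : ℝ) else 0)
    (x : Pt n) (X : Fin n → ℝ) :
    ∑ r, ∑ m, ginv x r m * (flat g ξ x r * X m) = ∑ m, ξ x m * X m := by
  rw [Finset.sum_comm]
  refine Finset.sum_congr rfl fun m _ => ?_
  rw [← sum_mul_sum_of_mul_eq_one (hinv x) (ξ x) m, Finset.sum_mul]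
  exact Finset.sum_congr rfl fun r _ => by rw [hginvsymm]; unfold flat; ring

theorem covD_flat_antisymm (hg : ∀ a b, ContDiff ℝ (⊤ : ℕ∞) fun x => g x a b)
    (hgsymm : ∀ x a b, g x a b = g x b a)
    (hinv' : ∀ x a b, (∑ c, g x a c * ginv x c b) = if a = b then (1 : ℝ) else 0)
    (hξ : ContDiff ℝ (⊤ : ℕ∞) ξ) (hK : ∀ x a b, lieD g ξ x a b = 0) (x : Pt n) (a b : Fin n) :
    covD g ginv (flat g ξ) x a b = -covD g ginv (flat g ξ) x b a := by
  have h : ∀ a b, ∑ m, g x b m * covV g ginv ξ x a m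
      = ∑ m, g x b m * pd (fun y => ξ y m) a x
        + ∑ e, (1/2) * (pd (fun y => g y b a) e x
      + pd (fun y => g y b e) a x - pd (fun y => g y a e) b x) * ξ x e := by
    intro a b
    unfold covV
    simp only [mul_add, Finset.sum_add_distrib, Finset.mul_sum, ← sum_g_mul_Chr hinv',
      Finset.sum_mul]
    congr 1
    rw [Finset.sum_comm]
    exact Finset.sum_congr rfl fun _ _ => Finset.sum_congr rfl fun _ _ => by ring
  rw [covD_flat hg hgsymm hinv' hξ, covD_flat hg hgsymm hinv' hξ, h, h, eq_neg_iff_add_eq_zero,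
    ← hK x a b]
  simp only [lieD, ← Finset.sum_add_distrib]
  refine Finset.sum_congr rfl fun c _ => ?_
  simp only [fun y => hgsymm y b a, fun y => hgsymm y c b]
  ring

theorem sum_mul_covD_flat_comm (hg : ∀ a b, ContDiff ℝ (⊤ : ℕ∞) fun x => g x a b)
    (hgsymm : ∀ x a b, g x a b = g x b a)
    (hinv' : ∀ x a b, (∑ c, g x a c * ginv x c b) = if a = b then (1 : ℝ) else 0)
    (hξ : ContDiff ℝ (⊤ : ℕ∞) ξ) (hη : ContDiff ℝ (⊤ : ℕ∞) η) (hcomm : ∀ x, lieBr ξ η x = 0)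
    (x : Pt n) (b : Fin n) :
    ∑ m, η x m * covD g ginv (flat g ξ) x m b = ∑ m, ξ x m * covD g ginv (flat g η) x m b := by
  have h : ∀ k, ∑ m, η x m * covV g ginv ξ x m k = ∑ m, ξ x m * covV g ginv η x m k := by
    intro k
    have hk : ∑ m, (ξ x m * pd (fun y => η y k) m x - η x m * pd (fun y => ξ y k) m x) = 0 :=
      congrFun (hcomm x) k
    have hs : ∑ m, ∑ e, η x m * (Chr g ginv k m e x * ξ x e)
        = ∑ m, ∑ e, ξ x m * (Chr g ginv k m e x * η x e) := by
      rw [Finset.sum_comm]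
      exact Finset.sum_congr rfl fun _ _ => Finset.sum_congr rfl fun _ _ => by
        rw [Chr_symm hgsymm]; ring
    rw [Finset.sum_sub_distrib] at hk
    simp only [covV, mul_add, Finset.sum_add_distrib, Finset.mul_sum]
    rw [hs]
    linarith
  have h' : ∀ ζ ω : Pt n → Pt n, ∑ m, ζ x m * ∑ k, g x b k * covV g ginv ω x m k
      = ∑ k, g x b k * ∑ m, ζ x m * covV g ginv ω x m k := by
    intro ζ ω
    simp only [Finset.mul_sum]
    rw [Finset.sum_comm]
    exact Finset.sum_congr rfl fun _ _ => Finset.sum_congr rfl fun _ _ => by ring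
  simp only [covD_flat hg hgsymm hinv' hξ, covD_flat hg hgsymm hinv' hη, h', h]

/-- The Lie derivative of `ξ_♭` along a Killing field `η` commuting with `ξ` vanishes. -/
theorem lie_flat_eq_zero (hg : ∀ a b, ContDiff ℝ (⊤ : ℕ∞) fun x => g x a b)
    (hξ : ContDiff ℝ (⊤ : ℕ∞) ξ)
    (hK : ∀ x a b, lieD g η x a b = 0) (hcomm : ∀ x, lieBr ξ η x = 0) (x : Pt n) (d : Fin n) :
    ∑ r, (η x r * pd (fun y => flat g ξ y d) r x + flat g ξ x r * pd (fun y => η y r) d x) = 0 := by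
  have dg : ∀ c d, DifferentiableAt ℝ (fun y => g y c d) x :=
    fun c d => (hg c d).differentiable (by simp) x
  have dξ : ∀ c, DifferentiableAt ℝ (fun y => ξ y c) x :=
    fun c => (contDiff_comp hξ c).differentiable (by simp) x
  have h1 : ∑ c, lieD g η x d c * ξ x c = 0 := by simp [hK]
  have h2 : ∑ c, g x d c * lieBr ξ η x c = 0 := by simp [hcomm]
  have h3 : ∀ r, pd (fun y => flat g ξ y d) r x
      = ∑ c, (g x d c * pd (fun y => ξ y c) r x + ξ x c * pd (fun y => g y d c) r x) := by
    intro r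
    unfold flat
    rw [pd_sum _ fun c _ => (dg d c).fun_mul (dξ c)]
    exact Finset.sum_congr rfl fun c _ => pd_mul (dg d c) (dξ c) r
  have h4 : ∑ c, ∑ e, g x d c * (ξ x e * pd (fun y => η y c) e x)
      = ∑ c, ∑ e, g x d e * pd (fun y => η y e) c x * ξ x c := by
    rw [Finset.sum_comm]
    exact Finset.sum_congr rfl fun _ _ => Finset.sum_congr rfl fun _ _ => by ring
  have h5 : ∑ r, ∑ c, η x r * (g x d c * pd (fun y => ξ y c) r x)
      = ∑ c, ∑ e, g x d c * (η x e * pd (fun y => ξ y c) e x) := by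
    rw [Finset.sum_comm]
    exact Finset.sum_congr rfl fun _ _ => Finset.sum_congr rfl fun _ _ => by ring
  have h6 : ∑ r, ∑ c, η x r * (ξ x c * pd (fun y => g y d c) r x)
      = ∑ c, ∑ e, η x e * pd (fun y => g y d c) e x * ξ x c := by
    rw [Finset.sum_comm]
    exact Finset.sum_congr rfl fun _ _ => Finset.sum_congr rfl fun _ _ => by ring
  have h7 : ∑ r, ∑ c, g x r c * ξ x c * pd (fun y => η y r) d x
      = ∑ c, ∑ e, g x e c * pd (fun y => η y e) d x * ξ x c := by
    rw [Finset.sum_comm]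
    exact Finset.sum_congr rfl fun _ _ => Finset.sum_congr rfl fun _ _ => by ring
  simp only [lieD, lieBr, Finset.sum_mul, Finset.mul_sum, add_mul, mul_sub, Finset.sum_add_distrib,
    Finset.sum_sub_distrib] at h1 h2
  simp only [h3]
  simp only [flat, Finset.sum_mul, Finset.mul_sum, mul_add, Finset.sum_add_distrib]
  rw [h5, h6, h7]
  rw [h4] at h2
  linarith

theorem covD_flat_eq_half_curl (hg : ∀ a b, ContDiff ℝ (⊤ : ℕ∞) fun x => g x a b)
    (hgsymm : ∀ x a b, g x a b = g x b a)
    (hinv' : ∀ x a b, (∑ c, g x a c * ginv x c b) = if a = b then (1 : ℝ) else 0)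
    (hξ : ContDiff ℝ (⊤ : ℕ∞) ξ) (hK : ∀ x a b, lieD g ξ x a b = 0) (x : Pt n) (a b : Fin n) :
    covD g ginv (flat g ξ) x a b
      = (1/2) * (pd (fun y => flat g ξ y b) a x - pd (fun y => flat g ξ y a) b x) := by
  have h := covD_flat_antisymm hg hgsymm hinv' hξ hK x a b
  have h' : covD g ginv (flat g ξ) x a b - covD g ginv (flat g ξ) x b a
      = pd (fun y => flat g ξ y b) a x - pd (fun y => flat g ξ y a) b x := by
    unfold covD
    simp only [fun c => Chr_symm (ginv := ginv) hgsymm c b a x]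
    ring
  linarith

/-- The Lie derivative of `∇ξ_♭` along a Killing field `η` commuting with `ξ` vanishes. -/
theorem sum_mul_covD2_covD_flat (hg : ∀ a b, ContDiff ℝ (⊤ : ℕ∞) fun x => g x a b)
    (hgsymm : ∀ x a b, g x a b = g x b a)
    (hinv' : ∀ x a b, (∑ c, g x a c * ginv x c b) = if a = b then (1 : ℝ) else 0)
    (hξ : ContDiff ℝ (⊤ : ℕ∞) ξ) (hη : ContDiff ℝ (⊤ : ℕ∞) η)
    (hKξ : ∀ x a b, lieD g ξ x a b = 0) (hKη : ∀ x a b, lieD g η x a b = 0)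
    (hcomm : ∀ x, lieBr ξ η x = 0) (x : Pt n) (c d : Fin n) :
    ∑ m, η x m * covD2 g ginv (covD g ginv (flat g ξ)) x m c d
      = ∑ r, covV g ginv η x d r * covD g ginv (flat g ξ) x r c
        - ∑ r, covV g ginv η x c r * covD g ginv (flat g ξ) x r d := by
  have cη := contDiff_comp hη
  have cξ := contDiff_flat hg hξ
  have D : ∀ {f : Pt n → ℝ}, ContDiff ℝ (⊤ : ℕ∞) f → DifferentiableAt ℝ f x :=
    fun hf => hf.differentiable (by simp) x
  have curl := covD_flat_eq_half_curl hg hgsymm hinv' hξ hKξ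
  have anti := covD_flat_antisymm hg hgsymm hinv' hξ hKξ
  have hlie : ∀ c d, ∑ r, (η x r * pd (pd (fun y => flat g ξ y d) r) c x
      + pd (fun y => flat g ξ y d) r x * pd (fun y => η y r) c x
      + (flat g ξ x r * pd (pd (fun y => η y r) d) c x
      + pd (fun y => η y r) d x * pd (fun y => flat g ξ y r) c x)) = 0 := by
    intro c d
    have h0 : pd (fun z => ∑ r, (η z r * pd (fun y => flat g ξ y d) r z
        + flat g ξ z r * pd (fun y => η y r) d z)) c x = 0 := by
      simp only [lie_flat_eq_zero hg hξ hKη hcomm]; simp [pd]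
    rw [pd_sum _ fun r _ => ((D (cη r)).fun_mul (D (contDiff_pd (cξ d) r))).fun_add
      ((D (cξ r)).fun_mul (D (contDiff_pd (cη r) d)))] at h0
    rw [← h0]
    refine Finset.sum_congr rfl fun r _ => ?_
    rw [pd_add ((D (cη r)).fun_mul (D (contDiff_pd (cξ d) r)))
      ((D (cξ r)).fun_mul (D (contDiff_pd (cη r) d))),
      pd_mul (D (cη r)) (D (contDiff_pd (cξ d) r)), pd_mul (D (cξ r)) (D (contDiff_pd (cη r) d))]
  have hF : ∀ m, pd (fun y => covD g ginv (flat g ξ) y c d) m x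
      = (1/2) * (pd (pd (fun y => flat g ξ y d) c) m x - pd (pd (fun y => flat g ξ y c) d) m x) := by
    intro m
    have d1 := D (contDiff_pd (cξ d) c)
    have d2 := D (contDiff_pd (cξ c) d)
    simp only [curl]
    rw [pd_const_mul (d1.fun_sub d2), pd_sub d1 d2]
  have main : ∑ r, (η x r * pd (fun y => covD g ginv (flat g ξ) y c d) r x
      + pd (fun y => η y r) c x * covD g ginv (flat g ξ) x r d
      - pd (fun y => η y r) d x * covD g ginv (flat g ξ) x r c) = 0 := by
    have h := congrArg₂ (· - ·) (hlie c d) (hlie d c)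
    rw [← Finset.sum_sub_distrib] at h
    rw [← mul_zero (1/2 : ℝ), ← sub_zero (0 : ℝ), ← h, Finset.mul_sum]
    refine Finset.sum_congr rfl fun r _ => ?_
    rw [hF, curl, curl, pd_comm (cξ d) r c, pd_comm (cξ c) r d, pd_comm (cη r) c d]
    ring
  have e1 : ∀ c d, ∑ r, ∑ e, Chr g ginv r c e x * η x e * covD g ginv (flat g ξ) x r d
      = ∑ m, ∑ e, η x m * (Chr g ginv e m c x * covD g ginv (flat g ξ) x e d) := by
    intro c d
    rw [Finset.sum_comm]
    exact Finset.sum_congr rfl fun _ _ => Finset.sum_congr rfl fun _ _ => by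
      rw [Chr_symm hgsymm]; ring
  have e2 : ∑ m, ∑ e, η x m * (Chr g ginv e m d x * covD g ginv (flat g ξ) x c e)
      = -∑ m, ∑ e, η x m * (Chr g ginv e m d x * covD g ginv (flat g ξ) x e c) := by
    simp only [anti x c, ← Finset.sum_neg_distrib]
    exact Finset.sum_congr rfl fun _ _ => Finset.sum_congr rfl fun _ _ => by ring
  simp only [Finset.sum_sub_distrib, Finset.sum_add_distrib] at main
  simp only [covD2, covV, add_mul, mul_sub, Finset.sum_sub_distrib, Finset.sum_add_distrib,
    Finset.sum_mul, Finset.mul_sum, e1]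
  rw [e2]
  linarith

/-- A Killing field `ξ` satisfies `∇^r ∇_c ξ_r = R_{cf} ξ^f`. -/
theorem div_covD_flat (hg : ∀ a b, ContDiff ℝ (⊤ : ℕ∞) fun x => g x a b)
    (hginv : ∀ a b, ContDiff ℝ (⊤ : ℕ∞) fun x => ginv x a b)
    (hgsymm : ∀ x a b, g x a b = g x b a)
    (hginvsymm : ∀ x a b, ginv x a b = ginv x b a)
    (hinv : ∀ x a b, (∑ c, ginv x a c * g x c b) = if a = b then (1 : ℝ) else 0)
    (hinv' : ∀ x a b, (∑ c, g x a c * ginv x c b) = if a = b then (1 : ℝ) else 0)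
    (hξ : ContDiff ℝ (⊤ : ℕ∞) ξ) (hK : ∀ x a b, lieD g ξ x a b = 0) (x : Pt n) (c : Fin n) :
    ∑ r, ∑ m, ginv x r m * covD2 g ginv (covD g ginv (flat g ξ)) x m c r
      = ∑ f, RicciT g ginv c f x * ξ x f := by
  have D : ∀ {f : Pt n → ℝ}, ContDiff ℝ (⊤ : ℕ∞) f → DifferentiableAt ℝ f x :=
    fun hf => hf.differentiable (by simp) x
  have cξ := contDiff_comp hξ
  have cΓ := contDiff_Chr hg hginv
  have hs : ∀ a b c, Chr g ginv a b c = Chr g ginv a c b :=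
    fun a b c => funext fun y => Chr_symm hgsymm a b c y
  have hdiv : ∀ y, ∑ m, covV g ginv ξ y m m = 0 := by
    intro y
    have h : ∑ a, ∑ m, ginv y a m * covD g ginv (flat g ξ) y a m
        = -∑ a, ∑ m, ginv y a m * covD g ginv (flat g ξ) y a m := by
      conv_lhs => rw [Finset.sum_comm]
      simp only [← Finset.sum_neg_distrib]
      exact Finset.sum_congr rfl fun a _ => Finset.sum_congr rfl fun m _ => by
        rw [hginvsymm, covD_flat_antisymm hg hgsymm hinv' hξ hK]; ring
    simp only [← sum_inv_mul_covD_flat hg hgsymm hinv hinv' hξ]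
    linarith
  have hpd : ∀ a k m, pd (fun y => covV g ginv ξ y a k) m x
      = pd (pd (fun y => ξ y k) a) m x + ∑ e, (Chr g ginv k a e x * pd (fun y => ξ y e) m x
        + ξ x e * pd (Chr g ginv k a e) m x) := by
    intro a k m
    unfold covV
    rw [pd_add (D (contDiff_pd (cξ k) a))
      (DifferentiableAt.fun_sum fun e _ => (D (cΓ k a e)).fun_mul (D (cξ e))),
      pd_sum _ fun e _ => (D (cΓ k a e)).fun_mul (D (cξ e))]
    congr 1
    exact Finset.sum_congr rfl fun e _ => pd_mul (D (cΓ k a e)) (D (cξ e)) m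
  have hgrad : ∑ m, pd (fun y => covV g ginv ξ y m m) c x = 0 := by
    rw [← pd_sum _ fun m _ => D (contDiff_covV hg hginv hξ m m)]
    simp only [hdiv]; simp [pd]
  have htrace : ∑ r, ∑ m, ginv x r m * covD2 g ginv (covD g ginv (flat g ξ)) x m c r
      = ∑ m, (pd (fun y => covV g ginv ξ y c m) m x
          - ∑ e, Chr g ginv e m c x * covV g ginv ξ x e m
          + ∑ e, Chr g ginv m m e x * covV g ginv ξ x c e) := by
    rw [Finset.sum_comm]
    refine Finset.sum_congr rfl fun m _ => ?_
    simp only [covD2_covD_flat hg hginv hgsymm hinv' hξ, hginvsymm x _ m]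
    exact sum_mul_sum_of_mul_eq_one (hinv x) (fun k => pd (fun y => covV g ginv ξ y c k) m x
          - ∑ e, Chr g ginv e m c x * covV g ginv ξ x e k
          + ∑ e, Chr g ginv k m e x * covV g ginv ξ x c e) m
  rw [htrace]
  simp only [hpd] at hgrad ⊢
  simp only [fun f => RicciT_symm hg hginv hgsymm hginvsymm hinv hinv' x c f]
  simp only [covV, RicciT, Riem, mul_add, Finset.sum_add_distrib, Finset.sum_sub_distrib,
    Finset.mul_sum, Finset.sum_mul, add_mul, sub_mul] at hgrad ⊢
  have e1 : ∑ m, ∑ e, Chr g ginv m c e x * pd (fun y => ξ y e) m x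
      = ∑ m, ∑ e, Chr g ginv e m c x * pd (fun y => ξ y m) e x := by
    rw [Finset.sum_comm]
    exact Finset.sum_congr rfl fun m _ => Finset.sum_congr rfl fun e _ => by rw [hs]
  have e2 : ∑ m, ∑ e, ξ x e * pd (Chr g ginv m c e) m x
      = ∑ f, ∑ a, pd (Chr g ginv a c f) a x * ξ x f := by
    rw [Finset.sum_comm]
    exact Finset.sum_congr rfl fun m _ => Finset.sum_congr rfl fun e _ => by ring
  have e3 : ∑ m, ∑ e, ξ x e * pd (Chr g ginv m m e) c x
      = ∑ f, ∑ a, pd (Chr g ginv a a f) c x * ξ x f := by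
    rw [Finset.sum_comm]
    exact Finset.sum_congr rfl fun m _ => Finset.sum_congr rfl fun e _ => by ring
  have e4 : ∑ m, ∑ e, ∑ f, Chr g ginv m m e x * (Chr g ginv e c f x * ξ x f)
      = ∑ f, ∑ a, ∑ e, Chr g ginv a a e x * Chr g ginv e c f x * ξ x f := by
    simp only [← mul_assoc]
    rw [Finset.sum_comm_cycle]
  have e5 : ∑ m, ∑ e, ∑ f, Chr g ginv e m c x * (Chr g ginv m e f x * ξ x f)
      = ∑ f, ∑ a, ∑ e, Chr g ginv a c e x * Chr g ginv e a f x * ξ x f := by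
    rw [Finset.sum_comm_cycle]
    refine Finset.sum_congr rfl fun f _ => ?_
    rw [Finset.sum_comm]
    exact Finset.sum_congr rfl fun a _ => Finset.sum_congr rfl fun e _ => by rw [hs a e c]; ring
  have e6 : ∑ m, pd (pd (fun y => ξ y m) c) m x = ∑ m, pd (pd (fun y => ξ y m) m) c x :=
    Finset.sum_congr rfl fun m _ => pd_comm (cξ m) c m x
  rw [e3] at hgrad
  rw [e1, e2, e4, e5, e6]
  linarith

/-- `∇^ρ (η_[α ξ_β ∇_λ ξ_ρ]) = 0` for commuting Killing fields such that the Ricci tensor maps `ξ`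
into the span of `ξ` and `η`. -/
theorem div_asym4_flat_flat_covD_flat (hg : ∀ a b, ContDiff ℝ (⊤ : ℕ∞) fun x => g x a b)
    (hginv : ∀ a b, ContDiff ℝ (⊤ : ℕ∞) fun x => ginv x a b)
    (hgsymm : ∀ x a b, g x a b = g x b a)
    (hginvsymm : ∀ x a b, ginv x a b = ginv x b a)
    (hinv : ∀ x a b, (∑ c, ginv x a c * g x c b) = if a = b then (1 : ℝ) else 0)
    (hξ : ContDiff ℝ (⊤ : ℕ∞) ξ) (hη : ContDiff ℝ (⊤ : ℕ∞) η)
    (hKξ : ∀ x a b, lieD g ξ x a b = 0) (hKη : ∀ x a b, lieD g η x a b = 0)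
    (hcomm : ∀ x, lieBr ξ η x = 0) (x : Pt n) (p q : ℝ)
    (hR : ∀ α, (∑ μ, ∑ ρ, ginv x α μ * RicciT g ginv μ ρ x * ξ x ρ) = p * ξ x α + q * η x α)
    (α β lam : Fin n) :
    (∑ ρ, ∑ μ, ginv x ρ μ *
        covD4 g ginv
          (fun y a b l r =>
            asym4 (fun a' b' l' r' =>
              flat g η y a' * flat g ξ y b' * covD g ginv (flat g ξ) y l' r') a b l r)
          x μ α β lam ρ) = 0 := by
  have hinv' := sum_metric_mul_inv hgsymm hginvsymm hinv
  have D : ∀ {f : Pt n → ℝ}, ContDiff ℝ (⊤ : ℕ∞) f → DifferentiableAt ℝ f x :=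
    fun hf => hf.differentiable (by simp) x
  have dη := fun a => D (contDiff_flat hg hη a)
  have dξ := fun a => D (contDiff_flat hg hξ a)
  have dF := fun a b => D (contDiff_covD hg hginv (contDiff_flat hg hξ) a b)
  have antiξ := covD_flat_antisymm hg hgsymm hinv' hξ hKξ
  have antiη := covD_flat_antisymm hg hgsymm hinv' hη hKη
  have hself : ∀ x, lieBr ξ ξ x = 0 := fun x => by funext a; simp [lieBr]
  have hlie : ∀ ζ : Pt n → Pt n, ContDiff ℝ (⊤ : ℕ∞) ζ → (∀ x a b, lieD g ζ x a b = 0) →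
      (∀ x, lieBr ξ ζ x = 0) → ∀ c d,
      ∑ r, ∑ m, ginv x r m * (flat g ζ x r * covD2 g ginv (covD g ginv (flat g ξ)) x m c d)
        = ∑ r, ∑ m, ginv x r m * (covD g ginv (flat g ζ) x m c * covD g ginv (flat g ξ) x r d)
        - ∑ r, ∑ m, ginv x r m * (covD g ginv (flat g ζ) x m d * covD g ginv (flat g ξ) x r c) := by
    intro ζ hζ hKζ hc c d
    have hraise : ∀ c d, ∑ r, ∑ m, ginv x r m *
        (covD g ginv (flat g ζ) x m c * covD g ginv (flat g ξ) x r d)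
        = -∑ r, covV g ginv ζ x c r * covD g ginv (flat g ξ) x r d := by
      intro c d
      rw [← Finset.sum_neg_distrib]
      refine Finset.sum_congr rfl fun r _ => ?_
      rw [← sum_inv_mul_covD_flat hg hgsymm hinv hinv' hζ, Finset.sum_mul,
        ← Finset.sum_neg_distrib]
      exact Finset.sum_congr rfl fun m _ => by
        rw [covD_flat_antisymm hg hgsymm hinv' hζ hKζ x m c]; ring
    rw [sum_inv_mul_flat_mul hginvsymm hinv x
      (fun m => covD2 g ginv (covD g ginv (flat g ξ)) x m c d),
      sum_mul_covD2_covD_flat hg hgsymm hinv' hξ hζ hKξ hKζ hc, hraise, hraise]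
    ring
  have hdiv : ∀ c, ∑ r, ∑ m, ginv x r m * covD2 g ginv (covD g ginv (flat g ξ)) x m c r
      = p * flat g ξ x c + q * flat g η x c := by
    intro c
    rw [div_covD_flat hg hginv hgsymm hginvsymm hinv hinv' hξ hKξ,
      ← sum_mul_sum_of_mul_eq_one (hinv' x) (fun c => ∑ f, RicciT g ginv c f x * ξ x f) c]
    simp only [Finset.mul_sum, ← mul_assoc] at hR ⊢
    simp only [flat, Finset.mul_sum, ← Finset.sum_add_distrib]
    refine Finset.sum_congr rfl fun a _ => ?_
    simp only [mul_assoc, ← Finset.mul_sum] at hR ⊢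
    rw [hR]; ring
  have hD : ∀ m a b, covD2 g ginv (covD g ginv (flat g ξ)) x m a b
      = -covD2 g ginv (covD g ginv (flat g ξ)) x m b a := by
    intro m a b
    have h1 : pd (fun y => covD g ginv (flat g ξ) y a b) m x
        = -pd (fun y => covD g ginv (flat g ξ) y b a) m x := by
      simp only [fun y => antiξ y a b]
      simp [pd]
    unfold covD2
    rw [h1]
    simp only [fun e => antiξ x e b, fun e => antiξ x a e, mul_neg, Finset.sum_neg_distrib]
    ring
  have hEF : ∀ b, ∑ r, ∑ m, ginv x r m * (flat g η x r * covD g ginv (flat g ξ) x m b)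
      = ∑ r, ∑ m, ginv x r m * (flat g ξ x r * covD g ginv (flat g η) x m b) := by
    intro b
    rw [sum_inv_mul_flat_mul hginvsymm hinv x (fun m => covD g ginv (flat g ξ) x m b),
      sum_inv_mul_flat_mul hginvsymm hinv x (fun m => covD g ginv (flat g η) x m b)]
    exact sum_mul_covD_flat_comm hg hgsymm hinv' hξ hη hcomm x b
  rw [← trace_asym4_eq_zero (ginv x) (covD g ginv (flat g η) x) (covD g ginv (flat g ξ) x)
    (covD2 g ginv (covD g ginv (flat g ξ)) x) (flat g η x) (flat g ξ x) p q (hginvsymm x)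
    (antiη x) (antiξ x) hD hEF (hlie η hη hKη hcomm) (hlie ξ hξ hKξ hself) hdiv α β lam]
  refine Finset.sum_congr rfl fun r _ => Finset.sum_congr rfl fun m _ => ?_
  congr 1
  refine (covD4_asym4 g ginv (fun y a' b' l' r' =>
    flat g η y a' * flat g ξ y b' * covD g ginv (flat g ξ) y l' r') x
    (fun a b c d => ((dη a).fun_mul (dξ b)).fun_mul (dF c d)) m α β lam r).trans ?_
  congr 1
  funext a b c d
  exact covD4_mul_mul g ginv _ _ _ x dη dξ dF m a b c d

end Killing

/-- for two commuting Killing fields `ξ`, `η` whose span is an invariant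
2-plane of the Ricci tensor, the antisymmetrized quantities `η_[α ξ_β ∇_λ ξ_ρ]` and
`ξ_[α η_β ∇_λ η_ρ]` are covariantly divergence-free. -/
theorem divergence_free_of_ricci_invariant_plane {n : ℕ}
    (g ginv : Pt n → Fin n → Fin n → ℝ) (ξ η : Pt n → Pt n)
    (a₁ b₁ a₂ b₂ : Pt n → ℝ)
    (hg : ∀ a b, ContDiff ℝ (⊤ : ℕ∞) fun x => g x a b)
    (hginv : ∀ a b, ContDiff ℝ (⊤ : ℕ∞) fun x => ginv x a b)
    (hgsymm : ∀ x a b, g x a b = g x b a)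
    (hginvsymm : ∀ x a b, ginv x a b = ginv x b a)
    (hinv : ∀ x a b, (∑ c, ginv x a c * g x c b) = if a = b then (1:ℝ) else 0)
    (hξ : ContDiff ℝ (⊤ : ℕ∞) ξ) (hη : ContDiff ℝ (⊤ : ℕ∞) η)
    (hKξ : ∀ x a b, lieD g ξ x a b = 0)   -- ξ is Killing
    (hKη : ∀ x a b, lieD g η x a b = 0)   -- η is Killing
    (hcomm : ∀ x, lieBr ξ η x = 0)        -- [ξ, η] = 0
    -- the Ricci tensor leaves the 2-plane spanned by ξ and η invariant:
    (hRξ : ∀ x (α : Fin n),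
      (∑ μ, ∑ ρ, ginv x α μ * RicciT g ginv μ ρ x * ξ x ρ) = a₁ x * ξ x α + b₁ x * η x α)
    (hRη : ∀ x (α : Fin n),
      (∑ μ, ∑ ρ, ginv x α μ * RicciT g ginv μ ρ x * η x ρ) = a₂ x * ξ x α + b₂ x * η x α) :
    ∀ x (α β lam : Fin n),
      (∑ ρ, ∑ μ, ginv x ρ μ *
        covD4 g ginv
          (fun y a b l r =>
            asym4 (fun a' b' l' r' =>
              flat g η y a' * flat g ξ y b' * covD g ginv (flat g ξ) y l' r') a b l r)
          x μ α β lam ρ) = 0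
      ∧
      (∑ ρ, ∑ μ, ginv x ρ μ *
        covD4 g ginv
          (fun y a b l r =>
            asym4 (fun a' b' l' r' =>
              flat g ξ y a' * flat g η y b' * covD g ginv (flat g η) y l' r') a b l r)
          x μ α β lam ρ) = 0 := by
  have hcomm' : ∀ x, lieBr η ξ x = 0 := fun x => by
    funext a
    have h := congrFun (hcomm x) a
    simp only [lieBr, Finset.sum_sub_distrib, Pi.zero_apply] at h ⊢
    linarith
  exact fun x α β lam =>
    ⟨div_asym4_flat_flat_covD_flat hg hginv hgsymm hginvsymm hinv hξ hη hKξ hKη hcomm x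
        (a₁ x) (b₁ x) (hRξ x) α β lam,
      div_asym4_flat_flat_covD_flat hg hginv hgsymm hginvsymm hinv hη hξ hKη hKξ hcomm' x
        (b₂ x) (a₂ x) (fun α => by rw [hRη, add_comm]) α β lam⟩
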